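/- If x ∈ [0,1) is such that D_n(x) = 0 for infinitely many indices n, then the level set L_f(f(x)) = {x′ ∈ [0,1] : f(x′) = f(x)} has the cardinality of the continuum. -/

import Mathlib

/-- `phi x` is the distance from `x` to the nearest integer. -/
noncomputable def phi (x : ℝ) : ℝ := |x - round x|

/-- The signed Takagi function associated to the sign sequence `r`. -/
noncomputable def takagi (r : ℕ → ℝ) (x : ℝ) : ℝ :=
  ∑' n : ℕ, r n / 2 ^ n * phi (2 ^ n * x)

/-- `eps n x` is the `n`-th binary digit of `x ∈ [0,1)` (for `n ≥ 1`), using the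
terminating expansion for dyadic rationals. -/
noncomputable def eps (n : ℕ) (x : ℝ) : ℕ := (⌊2 ^ n * x⌋ % 2).toNat

/-- `Dfun r k x = ∑_{j=1}^k r_{j-1} (-1)^{ε_j(x)}`. -/
noncomputable def Dfun (r : ℕ → ℝ) (k : ℕ) (x : ℝ) : ℝ :=
  ∑ j ∈ Finset.Icc 1 k, r (j - 1) * (-1 : ℝ) ^ eps j x

/-- `x = ∑ (1 - s n) / 2 ^ (n + 2)` is a binary expansion with digit signs `s`; the number `t n`
is the signed sum `∑ s (n + k) / 2 ^ (k + 1)`, characterised by its recursion. -/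
structure IsSignExpansion (s t : ℕ → ℝ) (x : ℝ) : Prop where
  sign : ∀ n, s n = 1 ∨ s n = -1
  bound : ∀ n, |t n| ≤ 1
  recurrence : ∀ n, 2 * t n = s n + t (n + 1)
  eq_half : x = (1 - t 0) / 2

theorem phi_add_int (y : ℝ) (m : ℤ) : phi (y + m) = phi y := by
  simp [phi, round_add_intCast]

theorem phi_eq_of_abs_le_one {t : ℝ} (ht : |t| ≤ 1) : phi ((1 - t) / 2) = (1 - |t|) / 2 := by
  obtain ⟨h1, h2⟩ := abs_le.mp ht
  rcases h1.eq_or_lt with h | h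
  · subst h
    norm_num [phi]
  · rw [phi, abs_sub_round_eq_min, Int.fract_eq_self.mpr ⟨by linarith, by linarith⟩]
    rcases le_total 0 t with h0 | h0
    · rw [abs_of_nonneg h0, min_eq_left (by linarith)]
    · rw [abs_of_nonpos h0, min_eq_right (by linarith)]
      ring

theorem summable_takagi {r : ℕ → ℝ} (hr : ∀ n, r n = 1 ∨ r n = -1) (x : ℝ) :
    Summable fun n : ℕ => r n / 2 ^ n * phi (2 ^ n * x) := by
  refine Summable.of_norm_bounded (g := fun n : ℕ => (1 / 2 : ℝ) ^ n)
    (summable_geometric_of_lt_one (by norm_num) (by norm_num)) fun n => ?_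
  have hphi : |phi (2 ^ n * x)| ≤ 1 := by
    rw [phi, abs_abs]
    exact (abs_sub_round _).trans (by norm_num)
  have hrn : |r n| = 1 := by rcases hr n with h | h <;> simp [h]
  rw [Real.norm_eq_abs, abs_mul, abs_div, hrn, abs_of_pos (by positivity : (0 : ℝ) < 2 ^ n),
    one_div_pow]
  exact mul_le_of_le_one_right (by positivity) hphi

namespace IsSignExpansion

variable {s t s' t' : ℕ → ℝ} {x x' : ℝ}

theorem mem_Icc (h : IsSignExpansion s t x) : x ∈ Set.Icc (0 : ℝ) 1 := by
  obtain ⟨h1, h2⟩ := abs_le.mp (h.bound 0)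
  rw [h.eq_half]
  constructor <;> linarith

theorem exists_int (h : IsSignExpansion s t x) (n : ℕ) :
    ∃ m : ℤ, 2 ^ n * x = (1 - t n) / 2 + m := by
  induction n with
  | zero => exact ⟨0, by simp [h.eq_half]⟩
  | succ n ih =>
    obtain ⟨m, hm⟩ := ih
    have hrec := h.recurrence n
    rcases h.sign n with hs | hs
    · refine ⟨2 * m, ?_⟩
      rw [pow_succ, mul_right_comm, hm]
      push_cast
      linarith
    · refine ⟨2 * m + 1, ?_⟩
      rw [pow_succ, mul_right_comm, hm]
      push_cast
      linarith

theorem phi_eq (h : IsSignExpansion s t x) (n : ℕ) :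
    phi (2 ^ n * x) = (1 - s n * t n) / 2 := by
  obtain ⟨m, hm⟩ := h.exists_int n
  rw [hm, phi_add_int, phi_eq_of_abs_le_one (h.bound n)]
  have hrec := h.recurrence n
  obtain ⟨h1, h2⟩ := abs_le.mp (h.bound (n + 1))
  rcases h.sign n with hs | hs
  · rw [abs_of_nonneg (by linarith), hs, one_mul]
  · rw [abs_of_nonpos (by linarith), hs, neg_one_mul]

/-- Summation by parts for the partial sums of the signed Takagi function. -/
theorem sum_range_takagi (h : IsSignExpansion s t x) {r D : ℕ → ℝ} (hD0 : D 0 = 0)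
    (hD : ∀ n, D (n + 1) = D n + r n * s n) (N : ℕ) :
    ∑ n ∈ Finset.range N, r n / 2 ^ n * phi (2 ^ n * x) =
      ∑ n ∈ Finset.range N, r n / 2 ^ (n + 1) -
        (D N * t N / 2 ^ N + ∑ n ∈ Finset.range N, D (n + 1) * s n / 2 ^ (n + 1)) / 2 := by
  induction N with
  | zero => simp [hD0]
  | succ N ih =>
    rw [Finset.sum_range_succ, Finset.sum_range_succ, Finset.sum_range_succ, ih, h.phi_eq]
    have ht : t (N + 1) = 2 * t N - s N := by linarith [h.recurrence N]
    rw [ht, hD]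
    field_simp
    ring

/-- Changing the digit signs by a factor that only jumps at zeros of `D` does not change
the value of the signed Takagi function. -/
theorem takagi_eq (h : IsSignExpansion s t x) (h' : IsSignExpansion s' t' x') {r D c : ℕ → ℝ}
    (hr : ∀ n, r n = 1 ∨ r n = -1) (hD0 : D 0 = 0) (hD : ∀ n, D (n + 1) = D n + r n * s n)
    (hzero : {n | D n = 0}.Infinite) (hs' : ∀ n, s' n = c n * s n)
    (hc : ∀ n, c n = 1 ∨ c n = -1) (hjump : ∀ n, D (n + 1) = 0 ∨ c (n + 1) = c n) :
    takagi r x' = takagi r x := by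
  set D' : ℕ → ℝ := fun N => ∑ n ∈ Finset.range N, r n * s' n with hD'_def
  have hD' : ∀ n, D' (n + 1) = D' n + r n * s' n := fun n => Finset.sum_range_succ _ _
  have hD'0 : D' 0 = 0 := by simp [hD'_def]
  have hDD' : ∀ n, D' (n + 1) = c n * D (n + 1) := by
    intro n
    induction n with
    | zero => rw [hD', hD, hD'0, hD0, hs']; ring
    | succ n ih =>
      rw [hD', hD (n + 1), ih, hs']
      rcases hjump n with h0 | h0
      · rw [h0]; ring
      · rw [h0]; ring
  have hfreq : ∃ᶠ N in Filter.atTop,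
      ∑ n ∈ Finset.range N, r n / 2 ^ n * phi (2 ^ n * x') =
        ∑ n ∈ Finset.range N, r n / 2 ^ n * phi (2 ^ n * x) := by
    refine (Nat.frequently_atTop_iff_infinite.mpr hzero).mono fun N hN => ?_
    have hN' : D' N = 0 := by
      cases N with
      | zero => exact hD'0
      | succ N => rw [hDD', hN, mul_zero]
    have hterm : ∀ n, D' (n + 1) * s' n = D (n + 1) * s n := by
      intro n
      rw [hDD', hs']
      rcases hc n with h0 | h0 <;> rw [h0] <;> ring
    simp only [h.sum_range_takagi hD0 hD, h'.sum_range_takagi hD'0 hD', hN, hN', hterm, zero_mul]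
  exact tendsto_nhds_unique_of_frequently_eq
    (summable_takagi hr x').hasSum.tendsto_sum_nat (summable_takagi hr x).hasSum.tendsto_sum_nat
    hfreq

theorem sign_eq_neg_one_of_eq_neg_one (h : IsSignExpansion s t x) {n : ℕ} (hn : t n = -1) :
    ∀ m, n ≤ m → s m = -1 := by
  have key : ∀ m, t m = -1 → s m = -1 ∧ t (m + 1) = -1 := by
    intro m hm
    have hrec := h.recurrence m
    have h1 := (abs_le.mp (h.bound (m + 1))).1
    rcases h.sign m with hs | hs
    · linarith
    · exact ⟨hs, by linarith⟩
  have ht : ∀ m, n ≤ m → t m = -1 := by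
    intro m hm
    induction m, hm using Nat.le_induction with
    | base => exact hn
    | succ m _ ih => exact (key m ih).2
  exact fun m hm => (key m (ht m hm)).1

theorem sign_le_of_forall_lt_eq (h : IsSignExpansion s t x) (h' : IsSignExpansion s' t' x)
    (hs : ∀ n, ∃ m, n ≤ m ∧ s m = 1) {p : ℕ} (hlt : ∀ n < p, s n = s' n) : s p ≤ s' p := by
  have ht : ∀ n ≤ p, t n = t' n := by
    intro n hn
    induction n with
    | zero => linarith [h.eq_half, h'.eq_half]
    | succ n ih => linarith [h.recurrence n, h'.recurrence n, ih (by omega), hlt n (by omega)]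
  have htp := ht p le_rfl
  have hrec := h.recurrence p
  have hrec' := h'.recurrence p
  have h1 := (abs_le.mp (h.bound (p + 1))).1
  have h2 := (abs_le.mp (h'.bound (p + 1))).2
  rcases h.sign p with hsp | hsp <;> rcases h'.sign p with hsp' | hsp'
  · linarith
  · obtain ⟨m, hm, hm1⟩ := hs (p + 1)
    have := h.sign_eq_neg_one_of_eq_neg_one (n := p + 1) (by linarith) m hm
    linarith
  · linarith
  · linarith

theorem sign_unique (h : IsSignExpansion s t x) (h' : IsSignExpansion s' t' x)
    (hs : ∀ n, ∃ m, n ≤ m ∧ s m = 1) (hs' : ∀ n, ∃ m, n ≤ m ∧ s' m = 1) : s = s' := by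
  funext p
  induction p using Nat.strong_induction_on with
  | _ p ih =>
    exact le_antisymm (h.sign_le_of_forall_lt_eq h' hs ih)
      (h'.sign_le_of_forall_lt_eq h hs' fun n hn => (ih n hn).symm)

end IsSignExpansion

theorem exists_isSignExpansion {s : ℕ → ℝ} (hs : ∀ n, s n = 1 ∨ s n = -1) :
    ∃ t x, IsSignExpansion s t x := by
  have habs : ∀ n, |s n| = 1 := fun n => by rcases hs n with h | h <;> simp [h]
  have hnorm : ∀ n k, ‖s (n + k) / 2 / 2 ^ k‖ = 1 / 2 / 2 ^ k := by
    intro n k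
    rw [Real.norm_eq_abs, abs_div, abs_div, habs, abs_of_pos (by positivity : (0 : ℝ) < 2 ^ k),
      abs_of_pos (by norm_num : (0 : ℝ) < 2)]
  have hsum : ∀ n, Summable fun k => s (n + k) / 2 / 2 ^ k := fun n =>
    Summable.of_norm_bounded (summable_geometric_two' 1) fun k => (hnorm n k).le
  refine ⟨fun n => ∑' k, s (n + k) / 2 / 2 ^ k, _, hs, fun n => ?_, fun n => ?_, rfl⟩
  · have := tsum_of_norm_bounded (hasSum_geometric_two' 1) fun k => (hnorm n k).le
    simpa using this
  · rw [(hsum n).tsum_eq_zero_add, mul_add, ← tsum_mul_left]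
    congr 1
    · simp
      ring
    · refine tsum_congr fun k => ?_
      rw [add_assoc, add_comm 1 k, pow_succ]
      field_simp

theorem eps_succ_eq (n : ℕ) (x : ℝ) :
    (eps (n + 1) x : ℤ) = ⌊2 ^ (n + 1) * x⌋ - 2 * ⌊2 ^ n * x⌋ ∧
      (eps (n + 1) x = 0 ∨ eps (n + 1) x = 1) := by
  have h1 : 2 * ⌊2 ^ n * x⌋ ≤ ⌊2 ^ (n + 1) * x⌋ := by
    rw [Int.le_floor, pow_succ]
    push_cast
    linarith [Int.floor_le (2 ^ n * x)]
  have h2 : ⌊2 ^ (n + 1) * x⌋ < 2 * ⌊2 ^ n * x⌋ + 2 := by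
    rw [Int.floor_lt, pow_succ]
    push_cast
    linarith [Int.lt_floor_add_one (2 ^ n * x)]
  unfold eps
  omega

theorem isSignExpansion_eps {x : ℝ} (hx : x ∈ Set.Ico (0 : ℝ) 1) :
    IsSignExpansion (fun n => (-1) ^ eps (n + 1) x) (fun n => 1 - 2 * Int.fract (2 ^ n * x)) x where
  sign n := neg_one_pow_eq_or ℝ _
  bound n := by
    rw [abs_le]
    constructor <;> linarith [Int.fract_nonneg (2 ^ n * x), Int.fract_lt_one (2 ^ n * x)]
  recurrence n := by
    obtain ⟨h1, h2⟩ := eps_succ_eq n x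
    have h3 : (eps (n + 1) x : ℝ) = ⌊2 ^ (n + 1) * x⌋ - 2 * ⌊2 ^ n * x⌋ := by exact_mod_cast h1
    have h4 : (-1 : ℝ) ^ eps (n + 1) x = 1 - 2 * eps (n + 1) x := by
      rcases h2 with h | h <;> rw [h] <;> norm_num
    simp only [Int.fract]
    rw [h4, h3, pow_succ]
    ring
  eq_half := by
    simp [Int.fract_eq_self.mpr hx]

theorem Dfun_succ (r : ℕ → ℝ) (n : ℕ) (x : ℝ) :
    Dfun r (n + 1) x = Dfun r n x + r n * (-1) ^ eps (n + 1) x := by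
  rw [Dfun, Finset.sum_Icc_succ_top (by omega), Nat.add_sub_cancel, Dfun]

/-- The sign sequence `a 0, -a 0, a 1, -a 1, …`. -/
def alternatingSigns (a : ℕ → Bool) (k : ℕ) : ℝ :=
  (-1) ^ k * if a (k / 2) then 1 else -1

theorem alternatingSigns_eq_or (a : ℕ → Bool) (k : ℕ) :
    alternatingSigns a k = 1 ∨ alternatingSigns a k = -1 := by
  unfold alternatingSigns
  rcases neg_one_pow_eq_or ℝ k with h | h <;> split_ifs <;> simp [h]

theorem alternatingSigns_injective : Function.Injective alternatingSigns := by
  intro a a' h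
  funext i
  have hi := congrFun h (2 * i)
  simp only [alternatingSigns, pow_mul, neg_one_sq, one_pow, one_mul,
    Nat.mul_div_cancel_left i two_pos] at hi
  cases h1 : a i <;> cases h2 : a' i <;> simp_all <;> norm_num at hi

theorem exists_alternatingSigns_eq_one (a : ℕ → Bool) (n : ℕ) :
    ∃ k, n ≤ k ∧ alternatingSigns a k = 1 := by
  cases h : a n
  · refine ⟨2 * n + 1, by omega, ?_⟩
    have : (2 * n + 1) / 2 = n := by omega
    simp [alternatingSigns, this, h, pow_succ, pow_mul]
  · exact ⟨2 * n, by omega, by simp [alternatingSigns, h, pow_mul]⟩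

/-- If `D_n(x) = 0` for infinitely many `n`, then the level set `L_f(f(x))` has
the cardinality of the continuum. -/
theorem level_set_continuum_of_infinitely_many_zeros
    (r : ℕ → ℝ) (hr : ∀ n, r n = 1 ∨ r n = -1)
    (x : ℝ) (hx : x ∈ Set.Ico (0 : ℝ) 1)
    (h : {n : ℕ | Dfun r n x = 0}.Infinite) :
    Cardinal.mk {x' : ℝ | x' ∈ Set.Icc (0 : ℝ) 1 ∧ takagi r x' = takagi r x}
      = Cardinal.continuum := by
  classical
  apply le_antisymm
  · exact (Cardinal.mk_set_le _).trans Cardinal.mk_real.le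
  have hexp := isSignExpansion_eps hx
  set s : ℕ → ℝ := fun n => (-1) ^ eps (n + 1) x with hs_def
  set p : ℕ → Prop := fun n => Dfun r n x = 0 with hp_def
  -- `z k` is the `k`-th zero, and `b m` the index of the block containing the digit `m`
  set z : ℕ → ℕ := Nat.nth p with hz_def
  set b : ℕ → ℕ := fun m => Nat.count p (m + 1) - 1 with hb_def
  have hbz : ∀ k, b (z k) = k := by
    intro k
    simp only [hb_def, hz_def]
    rw [Nat.count_succ, Nat.count_nth_of_infinite h, if_pos (Nat.nth_mem_of_infinite h k)]
    omega
  set c : (ℕ → Bool) → ℕ → ℝ := fun a m => alternatingSigns a (b m) * s (z (b m)) with hc_def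
  have hc : ∀ a m, c a m = 1 ∨ c a m = -1 := by
    intro a m
    simp only [hc_def]
    rcases alternatingSigns_eq_or a (b m) with h1 | h1 <;>
      rcases hexp.sign (z (b m)) with h2 | h2 <;> simp [h1, h2]
  have hs' : ∀ a m, c a m * s m = 1 ∨ c a m * s m = -1 := by
    intro a m
    rcases hc a m with h1 | h1 <;> rcases hexp.sign m with h2 | h2 <;> simp [h1, h2]
  have hcz : ∀ a k, c a (z k) * s (z k) = alternatingSigns a k := by
    intro a k
    simp only [hc_def, hbz]
    rcases hexp.sign (z k) with h2 | h2 <;> rw [h2] <;> ring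
  have hjump : ∀ a m, Dfun r (m + 1) x = 0 ∨ c a (m + 1) = c a m := by
    intro a m
    refine or_iff_not_imp_left.mpr fun hm => ?_
    have : b (m + 1) = b m := by
      simp only [hb_def]
      rw [Nat.count_succ p (m + 1), if_neg hm, add_zero]
    simp only [hc_def, this]
  have hone : ∀ a n, ∃ m, n ≤ m ∧ c a m * s m = 1 := by
    intro a n
    obtain ⟨k, hk, hk1⟩ := exists_alternatingSigns_eq_one a n
    exact ⟨z k, hk.trans (Nat.nth_strictMono h).le_apply, (hcz a k).trans hk1⟩
  choose t y hy using fun a => exists_isSignExpansion (hs' a)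
  have hmem : ∀ a, y a ∈ Set.Icc (0 : ℝ) 1 ∧ takagi r (y a) = takagi r x := fun a =>
    ⟨(hy a).mem_Icc, hexp.takagi_eq (D := fun n => Dfun r n x) (c := c a) (hy a) hr
      (by simp [Dfun]) (fun n => Dfun_succ r n x) h (fun _ => rfl) (hc a) (hjump a)⟩
  have hinj : Function.Injective fun a : ℕ → Bool =>
      (⟨y a, hmem a⟩ : {x' : ℝ | x' ∈ Set.Icc (0 : ℝ) 1 ∧ takagi r x' = takagi r x}) := by
    intro a a' haa
    have hyy : y a = y a' := congrArg Subtype.val haa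
    have hsigns := (hy a).sign_unique (hyy ▸ hy a') (hone a) (hone a')
    refine alternatingSigns_injective (funext fun k => ?_)
    rw [← hcz, ← hcz]
    exact congrFun hsigns (z k)
  calc Cardinal.continuum = Cardinal.mk (ℕ → Bool) := by simp
    _ ≤ _ := Cardinal.mk_le_of_injective hinj
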